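/- arXiv:1207.0638 — 2 statements merged into one kernel-verified Lean document; each statement's English description precedes it below -/
import Mathlib

section
/- Let X be a finite abstract simplicial complex of dimension d. For τ ∈ X^{d-2} define the operator Δ+_τ : Ω^{d-1} → Ω^{d-1} by (Δ+_τ f)(σ) = deg_τ(σ) f(σ) − Σ_{σ'∼σ, τ⊆σ'} f(σ') when τ ⊂ σ, and (Δ+_τ f)(σ) = 0 when τ ⊄ σ, where deg_τ(σ) = #{σ' ∼ σ : τ ⊆ σ'}. Then Δ+ = (Σ_{τ∈X^{d-2}} Δ+_τ) − (d−1)·D, where D is the degree operator (Df)(σ) = deg(σ) f(σ). -/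
open Finset

/-- A finite abstract simplicial complex on the vertex type `V`: a collection of finite
subsets of `V` (the cells), closed under taking subsets and containing the empty cell. -/
structure SComplex (V : Type) [Fintype V] [DecidableEq V] : Type where
  cells : Finset (Finset V)
  empty_mem : ∅ ∈ cells
  down_closed : ∀ s ∈ cells, ∀ t ⊆ s, t ∈ cells

namespace SComplex

variable {V : Type} [Fintype V] [DecidableEq V]

/-- The cells of `X` with exactly `m` vertices, i.e. the `(m-1)`-dimensional cells `X^{m-1}`. -/
def cellsCard (X : SComplex V) (m : ℕ) : Finset (Finset V) :=
  X.cells.filter fun s => s.card = m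

/-- `X` is `D`-dimensional: every cell has at most `D+1` vertices and some cell has
exactly `D+1` vertices. -/
def Dim (X : SComplex V) (D : ℕ) : Prop :=
  (∀ s ∈ X.cells, s.card ≤ D + 1) ∧ ∃ s ∈ X.cells, s.card = D + 1

/-- `X` (of dimension `D`) has a complete skeleton: every subset of `V` with at most `D`
elements is a cell. -/
def CompleteSkeleton (X : SComplex V) (D : ℕ) : Prop :=
  ∀ s : Finset V, s.card ≤ D → s ∈ X.cells

/-- The set of vertices of an ordered tuple. -/
def tset {m : ℕ} (σ : Fin m → V) : Finset V := Finset.image σ Finset.univ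

/-- An ordered tuple of vertices is an oriented cell when it is injective and its vertex
set is a cell of `X`. -/
def IsCell (X : SComplex V) {m : ℕ} (σ : Fin m → V) : Prop :=
  Function.Injective σ ∧ tset σ ∈ X.cells

instance (X : SComplex V) {m : ℕ} (σ : Fin m → V) : Decidable (X.IsCell σ) := by
  unfold IsCell; infer_instance

/-- `X.nbr v σ` : the vertex `v` does not belong to `σ` and together with `σ` spans a
cell of `X`. -/
def nbr (X : SComplex V) {m : ℕ} (v : V) (σ : Fin m → V) : Prop :=
  v ∉ tset σ ∧ insert v (tset σ) ∈ X.cells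

instance (X : SComplex V) {m : ℕ} (v : V) (σ : Fin m → V) : Decidable (X.nbr v σ) := by
  unfold nbr; infer_instance

/-- `f` is an `(m-1)`-form on `X`: a function on ordered tuples of `m` vertices which is
skew-symmetric with respect to permutations of the tuple, and is supported on the
oriented `(m-1)`-cells of `X`. -/
def IsForm (X : SComplex V) (m : ℕ) (f : (Fin m → V) → ℝ) : Prop :=
  (∀ (σ : Fin m → V) (π : Equiv.Perm (Fin m)),
      f (σ ∘ π) = ((Equiv.Perm.sign π : ℤ) : ℝ) * f σ) ∧
  ∀ σ : Fin m → V, ¬ X.IsCell σ → f σ = 0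

/-- The space `Ω^{m-1}(X)` of `(m-1)`-forms, as a submodule of the functions on tuples. -/
def formSub (X : SComplex V) (m : ℕ) : Submodule ℝ ((Fin m → V) → ℝ) where
  carrier := {f | X.IsForm m f}
  add_mem' := @fun f g hf hg => ⟨fun σ π => by
      simp only [Pi.add_apply, hf.1 σ π, hg.1 σ π]; ring,
    fun σ h => by simp only [Pi.add_apply, hf.2 σ h, hg.2 σ h, add_zero]⟩
  zero_mem' := ⟨fun σ π => by simp, fun σ h => rfl⟩
  smul_mem' := @fun c f hf => ⟨fun σ π => by
      simp only [Pi.smul_apply, smul_eq_mul, hf.1 σ π]; ring,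
    fun σ h => by simp only [Pi.smul_apply, hf.2 σ h, smul_eq_mul, mul_zero]⟩

/-- The inner product `⟨f,g⟩ = ∑_{σ ∈ X^{m-1}} f(σ) g(σ)` on `(m-1)`-forms, computed via
ordered tuples (each cell is counted `m!` times, once for each ordering of its vertices). -/
noncomputable def innerForm (m : ℕ) (f g : (Fin m → V) → ℝ) : ℝ :=
  ((m.factorial : ℝ))⁻¹ * ∑ σ : Fin m → V, f σ * g σ

/-- The boundary operator `∂ : Ω^m → Ω^{m-1}`, `(∂f)(σ) = ∑_{v ∼ σ} f(vσ)`. -/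
def bdry (X : SComplex V) (m : ℕ) (f : (Fin (m+1) → V) → ℝ) : (Fin m → V) → ℝ :=
  fun σ => ∑ v : V, if X.nbr v σ then f (Fin.cons v σ) else 0

/-- The coboundary operator `∂* : Ω^{m-1} → Ω^m`, `(∂*f)(σ) = ∑ i (-1)^i f(σ ∖ σᵢ)`,
supported on the oriented `m`-cells of `X`. -/
def cobdry (X : SComplex V) (m : ℕ) (f : (Fin m → V) → ℝ) : (Fin (m+1) → V) → ℝ :=
  fun σ => if X.IsCell σ then ∑ i : Fin (m+1), (-1 : ℝ) ^ (i : ℕ) * f (σ ∘ i.succAbove) else 0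

/-- The upper Laplacian `Δ⁺ = ∂ ∘ ∂*` on `(m-1)`-forms. -/
def upLap (X : SComplex V) (m : ℕ) (f : (Fin m → V) → ℝ) : (Fin m → V) → ℝ :=
  X.bdry m (X.cobdry m f)

/-- The lower Laplacian `Δ⁻ = ∂* ∘ ∂` on `m`-forms. -/
def lowLap (X : SComplex V) (m : ℕ) (f : (Fin (m+1) → V) → ℝ) : (Fin (m+1) → V) → ℝ :=
  X.cobdry m (X.bdry m f)

/-- The boundary operator as a linear map. -/
def bdryL (X : SComplex V) (m : ℕ) : ((Fin (m+1) → V) → ℝ) →ₗ[ℝ] ((Fin m → V) → ℝ) where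
  toFun := X.bdry m
  map_add' f g := by
    funext σ
    show (∑ v : V, if X.nbr v σ then (f + g) (Fin.cons v σ) else 0) =
      (∑ v : V, if X.nbr v σ then f (Fin.cons v σ) else 0) +
      (∑ v : V, if X.nbr v σ then g (Fin.cons v σ) else 0)
    rw [← Finset.sum_add_distrib]
    exact Finset.sum_congr rfl fun v _ => by by_cases h : X.nbr v σ <;> simp [h]
  map_smul' c f := by
    funext σ
    show (∑ v : V, if X.nbr v σ then (c • f) (Fin.cons v σ) else 0) =
      c * (∑ v : V, if X.nbr v σ then f (Fin.cons v σ) else 0)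
    rw [Finset.mul_sum]
    exact Finset.sum_congr rfl fun v _ => by by_cases h : X.nbr v σ <;> simp [h]

/-- The coboundary operator as a linear map. -/
def cobdryL (X : SComplex V) (m : ℕ) : ((Fin m → V) → ℝ) →ₗ[ℝ] ((Fin (m+1) → V) → ℝ) where
  toFun := X.cobdry m
  map_add' f g := by
    funext σ
    show X.cobdry m (f + g) σ = X.cobdry m f σ + X.cobdry m g σ
    unfold cobdry
    by_cases h : X.IsCell σ
    · simp only [h, if_true, ← Finset.sum_add_distrib]
      exact Finset.sum_congr rfl fun i _ => by simp [Pi.add_apply]; ring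
    · simp [h]
  map_smul' c f := by
    funext σ
    show X.cobdry m (c • f) σ = c * X.cobdry m f σ
    unfold cobdry
    by_cases h : X.IsCell σ
    · simp only [h, if_true, Finset.mul_sum]
      exact Finset.sum_congr rfl fun i _ => by simp [Pi.smul_apply]; ring
    · simp [h]

/-- The degree of a cell `s`: the number of cells with one more vertex containing `s`. -/
def degCell (X : SComplex V) (s : Finset V) : ℕ :=
  (X.cells.filter fun t => s ⊆ t ∧ t.card = s.card + 1).card

/-- The maximal degree of an `(m-1)`-cell of `X`. -/
def maxDeg (X : SComplex V) (m : ℕ) : ℕ :=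
  (X.cellsCard m).sup fun s => X.degCell s

/-- The spectrum of the upper Laplacian of a `(d+1)`-dimensional complex restricted to
the cycle space `Z = ker ∂` inside the space of forms on `d+1` vertices. -/
def specUpLapZ (X : SComplex V) (d : ℕ) : Set ℝ :=
  {μ | ∃ f : (Fin (d+1) → V) → ℝ,
    X.IsForm (d+1) f ∧ X.bdry d f = 0 ∧ f ≠ 0 ∧ X.upLap (d+1) f = μ • f}

/-- The spectral gap `λ(X) = min Spec (Δ⁺|_Z)` of a `(d+1)`-dimensional complex. -/
noncomputable def spectralGap (X : SComplex V) (d : ℕ) : ℝ :=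
  sInf (X.specUpLapZ d)

/-- `F(A 0, …, A (m-1))`: the set of cells with `m` vertices having exactly one vertex
in each `A i`. -/
def Fcells (X : SComplex V) {m : ℕ} (A : Fin m → Finset V) : Finset (Finset V) :=
  X.cells.filter fun s => s.card = m ∧ ∀ i, (s ∩ A i).card = 1

/-- The Cheeger constant of a `(d+1)`-dimensional complex: the minimum over all
partitions of the vertex set into `d+2` nonempty parts of `n·|F(A₀,…)|/∏|Aᵢ|`. -/
noncomputable def cheeger (X : SComplex V) (d : ℕ) : ℝ :=
  sInf { r : ℝ | ∃ A : Fin (d+2) → Finset V,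
    (∀ i, (A i).Nonempty) ∧ (∀ i j, i ≠ j → Disjoint (A i) (A j)) ∧
    Finset.univ.biUnion A = Finset.univ ∧
    r = (Fintype.card V : ℝ) * ((X.Fcells A).card : ℝ) / ∏ i, ((A i).card : ℝ) }

/-- The `m`-th reduced Betti number `β_m = dim H_m` of `X` over `ℝ`:
`dim (Ω^m ∩ ker ∂_m) - dim (∂_{m+1} Ω^{m+1})`. -/
noncomputable def betti (X : SComplex V) (m : ℕ) : ℕ :=
  Module.finrank ℝ ↥(X.formSub (m+1) ⊓ LinearMap.ker (X.bdryL m)) -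
  Module.finrank ℝ ↥(Submodule.map (X.bdryL (m+1)) (X.formSub (m+2)))

/-- The vertices of the link of `τ`. -/
def linkVerts (X : SComplex V) (τ : Finset V) : Finset V :=
  Finset.univ.filter fun v => v ∉ τ ∧ insert v τ ∈ X.cells

/-- The neighbours of `v` in the link graph of `τ`. -/
def linkNbrs (X : SComplex V) (τ : Finset V) (v : V) : Finset V :=
  Finset.univ.filter fun w => w ≠ v ∧ w ∉ τ ∧ v ∉ τ ∧ insert v (insert w τ) ∈ X.cells

/-- The graph Laplacian of the link of `τ`. -/
def linkLap (X : SComplex V) (τ : Finset V) (g : V → ℝ) : V → ℝ :=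
  fun v => ((X.linkNbrs τ v).card : ℝ) * g v - ∑ w ∈ X.linkNbrs τ v, g w

/-- The graph spectral gap of the link of `τ`: the minimal eigenvalue of its graph
Laplacian on functions on its vertices summing to zero. -/
noncomputable def linkGap (X : SComplex V) (τ : Finset V) : ℝ :=
  sInf {μ : ℝ | ∃ g : V → ℝ, (∀ v, v ∉ X.linkVerts τ → g v = 0) ∧
    (∑ v ∈ X.linkVerts τ, g v = 0) ∧ g ≠ 0 ∧
    ∀ v ∈ X.linkVerts τ, X.linkLap τ g v = μ * g v}

/-- The graph Cheeger constant of the link of `τ`: the minimum over partitions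
`B ⊔ C` of its vertex set of `|W|·|E(B,C)|/(|B|·|C|)`. -/
noncomputable def linkCheeger (X : SComplex V) (τ : Finset V) : ℝ :=
  sInf { r : ℝ | ∃ B C : Finset V, B.Nonempty ∧ C.Nonempty ∧ Disjoint B C ∧
    B ∪ C = X.linkVerts τ ∧
    r = ((X.linkVerts τ).card : ℝ) *
        (((B ×ˢ C).filter fun p => insert p.1 (insert p.2 τ) ∈ X.cells).card : ℝ) /
        ((B.card : ℝ) * (C.card : ℝ)) }

/-- `deg_τ(s)`: the number of neighbours `s'` of the cell `s` which contain `τ` (two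
distinct cells with the same number of vertices are neighbours when their union is a
cell of `X` with one more vertex). -/
def degTau (X : SComplex V) (τ s : Finset V) : ℕ :=
  (X.cells.filter fun s' => s'.card = s.card ∧ s' ≠ s ∧ τ ⊆ s' ∧
    (s ∪ s').card = s.card + 1 ∧ s ∪ s' ∈ X.cells).card

/-- The local upper Laplacian `Δ⁺_τ` associated to a cell `τ` with `d` vertices of a
`(d+1)`-dimensional complex, acting on forms on `d+1` vertices:
`(Δ⁺_τ f)(σ) = deg_τ(σ) f(σ) - ∑_{σ' ∼ σ, τ ⊆ σ'} f(σ')` when `τ ⊆ σ`, and `0` else. -/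
def localUpLap (X : SComplex V) (d : ℕ) (τ : Finset V) (f : (Fin (d+1) → V) → ℝ) :
    (Fin (d+1) → V) → ℝ :=
  fun σ => if τ ⊆ tset σ then
      (X.degTau τ (tset σ) : ℝ) * f σ -
        ∑ v : V, if X.nbr v σ then
          ∑ i : Fin (d+1), if σ i ∉ τ then
            (-1 : ℝ) ^ (i : ℕ) * f (Fin.cons v σ ∘ Fin.succAbove i.succ) else 0
        else 0
    else 0

/-- The complement complex `X̄` of a `D`-dimensional complex `X` with complete skeleton:
it has the same cells of dimension `< D`, and its `D`-dimensional cells are exactly the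
vertex sets of size `D+1` which are not cells of `X`. -/
def complComplex (X : SComplex V) (D : ℕ) (hX : X.CompleteSkeleton D) : SComplex V where
  cells := (X.cells.filter fun s => s.card ≤ D) ∪
    ((Finset.univ : Finset V).powersetCard (D+1)).filter fun s => s ∉ X.cells
  empty_mem := Finset.mem_union_left _ (Finset.mem_filter.mpr ⟨X.empty_mem, by simp⟩)
  down_closed := by
    intro s hs t ht
    rcases Finset.mem_union.mp hs with h | h
    · rw [Finset.mem_filter] at h
      exact Finset.mem_union_left _ (Finset.mem_filter.mpr
        ⟨X.down_closed s h.1 t ht, le_trans (Finset.card_le_card ht) h.2⟩)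
    · rw [Finset.mem_filter, Finset.mem_powersetCard] at h
      by_cases hts : t = s
      · subst hts
        exact Finset.mem_union_right _ (Finset.mem_filter.mpr
          ⟨Finset.mem_powersetCard.mpr h.1, h.2⟩)
      · have hlt : t.card < s.card := Finset.card_lt_card (ht.ssubset_of_ne hts)
        have hsD : s.card = D + 1 := h.1.2
        have htD : t.card ≤ D := by omega
        exact Finset.mem_union_left _ (Finset.mem_filter.mpr ⟨hX t htD, htD⟩)

/-- The simplicial complex on `V` with complete `(d+1)`-dimensional skeleton whose
top-dimensional cells (with `d+2` vertices) are the members of `T`: the Linial–Meshulam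
complex determined by the sample `T`. -/
def lmComplex (V : Type) [Fintype V] [DecidableEq V] (d : ℕ) (T : Finset (Finset V)) :
    SComplex V where
  cells := (Finset.univ.powerset.filter fun s : Finset V => s.card ≤ d + 1) ∪
    T.filter fun s => s.card = d + 2
  empty_mem := Finset.mem_union_left _ (by simp)
  down_closed := by
    intro s hs t ht
    rcases Finset.mem_union.mp hs with h | h
    · rw [Finset.mem_filter] at h
      exact Finset.mem_union_left _ (Finset.mem_filter.mpr
        ⟨Finset.mem_powerset.mpr (Finset.subset_univ t), le_trans (Finset.card_le_card ht) h.2⟩)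
    · rw [Finset.mem_filter] at h
      by_cases hts : t = s
      · subst hts; exact Finset.mem_union_right _ (Finset.mem_filter.mpr h)
      · have hlt : t.card < s.card := Finset.card_lt_card (ht.ssubset_of_ne hts)
        have hsd : s.card = d + 2 := h.2
        have htd : t.card ≤ d + 1 := by omega
        exact Finset.mem_union_left _ (Finset.mem_filter.mpr
          ⟨Finset.mem_powerset.mpr (Finset.subset_univ t), htd⟩)

open Classical in
/-- The probability, under the Linial–Meshulam measure `X(d+1, n, p)` (each possible
top-dimensional cell on `d+2` vertices is included independently with probability `p`),
of an event `E` depending on the set of top-dimensional cells. -/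
noncomputable def lmProb (V : Type) [Fintype V] [DecidableEq V] (d : ℕ) (p : ℝ)
    (E : Finset (Finset V) → Prop) : ℝ :=
  ∑ T ∈ ((Finset.univ : Finset V).powersetCard (d+2)).powerset,
    if E T then
      p ^ T.card * (1 - p) ^ (((Finset.univ : Finset V).powersetCard (d+2)).card - T.card)
    else 0

end SComplex

namespace SComplex

variable {V : Type} [DecidableEq V]

theorem mem_tset {m : ℕ} (σ : Fin m → V) (i : Fin m) : σ i ∈ tset σ :=
  mem_image_of_mem σ (mem_univ i)

theorem card_tset {m : ℕ} {σ : Fin m → V} (hσ : Function.Injective σ) : (tset σ).card = m := by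
  rw [tset, card_image_of_injective _ hσ, card_univ, Fintype.card_fin]

theorem injective_of_le_card_tset {m : ℕ} {σ : Fin m → V} (h : m ≤ (tset σ).card) :
    Function.Injective σ := by
  have hcard : (univ.image σ).card = (univ : Finset (Fin m)).card :=
    le_antisymm card_image_le (by simpa [tset] using h)
  exact Set.injOn_univ.mp (by simpa using card_image_iff.mp hcard)

theorem tset_cons {m : ℕ} (v : V) (σ : Fin m → V) :
    tset (Fin.cons v σ : Fin (m + 1) → V) = insert v (tset σ) := by
  ext x
  simp [tset, Fin.exists_fin_succ, eq_comm]

theorem filter_powersetCard_notMem (s : Finset V) (v : V) (m : ℕ) :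
    ((s.powersetCard m).filter fun τ => v ∉ τ) = (s.erase v).powersetCard m := by
  ext τ
  simp only [mem_filter, mem_powersetCard, subset_erase]
  tauto

variable [Fintype V]

theorem isCell_cons {X : SComplex V} {m : ℕ} {v : V} {σ : Fin m → V} (h : X.nbr v σ) :
    X.IsCell (Fin.cons v σ : Fin (m + 1) → V) ↔ Function.Injective σ := by
  have hv : v ∉ Set.range σ := by simpa [tset] using h.1
  simp [IsCell, tset_cons, Fin.cons_injective_iff, hv, h.2]

theorem nbr.tset_mem {X : SComplex V} {m : ℕ} {v : V} {σ : Fin m → V} (h : X.nbr v σ) :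
    tset σ ∈ X.cells :=
  X.down_closed _ h.2 _ (subset_insert _ _)

theorem card_linkVerts (X : SComplex V) (s : Finset V) :
    (X.linkVerts s).card = X.degCell s := by
  refine card_bij (fun v _ => insert v s) ?_ ?_ ?_
  · intro v hv
    simp only [linkVerts, mem_filter, mem_univ, true_and] at hv ⊢
    exact ⟨hv.2, subset_insert _ _, card_insert_of_notMem hv.1⟩
  · intro v hv w hw h
    simp only [linkVerts, mem_filter, mem_univ, true_and] at hv
    exact (insert_inj hv.1).mp h
  · intro t ht
    simp only [mem_filter] at ht
    obtain ⟨v, hv, rfl⟩ := exists_eq_insert_iff.mpr ⟨ht.2.1, ht.2.2.symm⟩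
    exact ⟨v, by simpa [linkVerts] using ⟨hv, ht.1⟩, rfl⟩

theorem degTau_eq_degCell (X : SComplex V) {τ s : Finset V} (hτs : τ ⊆ s)
    (hcard : τ.card + 1 = s.card) : X.degTau τ s = X.degCell s := by
  rw [← card_linkVerts]
  have union_insert_eq (v : V) : s ∪ insert v τ = insert v s := by
    rw [union_insert, union_eq_left.mpr hτs]
  symm
  refine card_bij (fun v _ => insert v τ) ?_ ?_ ?_
  · intro v hv
    simp only [linkVerts, mem_filter, mem_univ, true_and] at hv ⊢
    refine ⟨X.down_closed _ hv.2 _ (insert_subset_insert v hτs), ?_, ?_, subset_insert _ _, ?_, ?_⟩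
    · rw [card_insert_of_notMem fun h => hv.1 (hτs h), hcard]
    · rintro rfl
      exact hv.1 (mem_insert_self _ _)
    · rw [union_insert_eq, card_insert_of_notMem hv.1]
    · rw [union_insert_eq]
      exact hv.2
  · intro v hv w hw h
    simp only [linkVerts, mem_filter, mem_univ, true_and] at hv
    exact (insert_inj fun hv' => hv.1 (hτs hv')).mp h
  · intro t ht
    simp only [mem_filter] at ht
    obtain ⟨-, htc, -, hτt, hu, hmem⟩ := ht
    obtain ⟨v, -, rfl⟩ := exists_eq_insert_iff.mpr ⟨hτt, hcard.trans htc.symm⟩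
    rw [union_insert_eq] at hu hmem
    refine ⟨v, ?_, rfl⟩
    simp only [linkVerts, mem_filter, mem_univ, true_and]
    refine ⟨fun hv => ?_, hmem⟩
    rw [insert_eq_of_mem hv] at hu
    omega

theorem filter_cellsCard_subset (X : SComplex V) {s : Finset V} (hs : s ∈ X.cells) (m : ℕ) :
    ((X.cellsCard m).filter fun τ => τ ⊆ s) = s.powersetCard m := by
  ext τ
  simp only [cellsCard, mem_filter, mem_powersetCard]
  exact ⟨fun h => ⟨h.2, h.1.2⟩, fun h => ⟨⟨X.down_closed _ hs _ h.1, h.2⟩, h.1⟩⟩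

/-- The sum of `f(σ')` over the oriented cells `σ' ∼ σ`. -/
def adjSum (X : SComplex V) (d : ℕ) (f : (Fin (d + 1) → V) → ℝ) (σ : Fin (d + 1) → V) : ℝ :=
  ∑ v : V, if X.nbr v σ then
    ∑ i : Fin (d + 1), (-1 : ℝ) ^ (i : ℕ) * f (Fin.cons v σ ∘ Fin.succAbove i.succ) else 0

theorem upLap_apply_of_isCell (X : SComplex V) (d : ℕ) (f : (Fin (d + 1) → V) → ℝ)
    {σ : Fin (d + 1) → V} (hσ : X.IsCell σ) :
    X.upLap (d + 1) f σ = X.degCell (tset σ) * f σ - X.adjSum d f σ := by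
  have hdeg : (X.degCell (tset σ) : ℝ) * f σ = ∑ v : V, if X.nbr v σ then f σ else 0 := by
    rw [← card_linkVerts, ← sum_filter, sum_const, nsmul_eq_mul]
    rfl
  rw [hdeg, adjSum, ← sum_sub_distrib, upLap, bdry]
  refine sum_congr rfl fun v _ => ?_
  by_cases h : X.nbr v σ
  · have hcons : (Fin.cons v σ : Fin (d + 2) → V) ∘ Fin.succAbove 0 = σ := by
      funext i
      simp
    rw [if_pos h, if_pos h, if_pos h, cobdry, if_pos ((isCell_cons h).mpr hσ.1), Fin.sum_univ_succ,
      hcons, sub_eq_add_neg, ← sum_neg_distrib]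
    simp [pow_succ]
  · simp [h]

theorem upLap_apply_of_not_isCell (X : SComplex V) (m : ℕ) (f : (Fin m → V) → ℝ)
    {σ : Fin m → V} (hσ : ¬ X.IsCell σ) : X.upLap m f σ = 0 := by
  refine sum_eq_zero fun v _ => ?_
  split_ifs with h
  · exact if_neg fun hc => hσ ⟨(isCell_cons h).mp hc, h.tset_mem⟩
  · rfl

theorem localUpLap_apply_of_not_isCell (X : SComplex V) {d : ℕ} {τ : Finset V} (hτ : τ.card = d)
    {f : (Fin (d + 1) → V) → ℝ} {σ : Fin (d + 1) → V} (hσ : ¬ X.IsCell σ) (hfσ : f σ = 0) :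
    X.localUpLap d τ f σ = 0 := by
  unfold localUpLap
  split_ifs with hτσ
  · rw [hfσ, mul_zero, zero_sub, neg_eq_zero]
    refine sum_eq_zero fun v _ => ?_
    split_ifs with h
    · have hcard : (tset σ).card ≤ τ.card := by
        by_contra! hlt
        exact hσ ⟨injective_of_le_card_tset (by omega), h.tset_mem⟩
      refine sum_eq_zero fun i _ => if_neg ?_
      rw [not_not, eq_of_subset_of_card_le hτσ hcard]
      exact mem_tset σ i
    · rfl
  · rfl

theorem sum_localUpLap_apply_of_isCell (X : SComplex V) (d : ℕ) (f : (Fin (d + 1) → V) → ℝ)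
    {σ : Fin (d + 1) → V} (hσ : X.IsCell σ) :
    ∑ τ ∈ X.cellsCard d, X.localUpLap d τ f σ =
      (d + 1) * (X.degCell (tset σ) * f σ) - X.adjSum d f σ := by
  have hcard := card_tset hσ.1
  simp only [localUpLap]
  rw [← sum_filter, filter_cellsCard_subset X hσ.2, sum_sub_distrib]
  congr 1
  · have hdeg : ∀ τ ∈ (tset σ).powersetCard d,
        (X.degTau τ (tset σ) : ℝ) * f σ = X.degCell (tset σ) * f σ := by
      intro τ hτ
      rw [mem_powersetCard] at hτ
      rw [degTau_eq_degCell X hτ.1 (by rw [hτ.2, hcard])]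
    rw [sum_congr rfl hdeg, sum_const, card_powersetCard, hcard, nsmul_eq_mul]
    simp
  · rw [sum_comm]
    refine sum_congr rfl fun v _ => ?_
    by_cases h : X.nbr v σ
    · simp only [if_pos h]
      rw [sum_comm]
      refine sum_congr rfl fun i _ => ?_
      rw [← sum_filter, filter_powersetCard_notMem, sum_const, card_powersetCard,
        card_erase_of_mem (mem_tset σ i), hcard]
      simp
    · simp [h]

end SComplex

open SComplex in
/-- Garland's decomposition, Lemma 4.2(1): for a `(d+1)`-dimensional complex, on forms
one has `Δ⁺ = (∑_{τ ∈ X^{d-1}} Δ⁺_τ) - d·D`, where the sum runs over the cells `τ` with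
`d` vertices and `D` is the degree operator `(Df)(σ) = deg(σ)·f(σ)`. -/
theorem upLap_eq_sum_localUpLap (V : Type) [Fintype V] [DecidableEq V] (d : ℕ)
    (X : SComplex V) (hdim : X.Dim (d + 1))
    (f : (Fin (d + 1) → V) → ℝ) (hf : X.IsForm (d + 1) f) :
    X.upLap (d + 1) f =
      (∑ τ ∈ X.cellsCard d, X.localUpLap d τ f) -
        (d : ℝ) • (fun σ => (X.degCell (SComplex.tset σ) : ℝ) * f σ) := by
  funext σ
  simp only [Pi.sub_apply, Finset.sum_apply, Pi.smul_apply, smul_eq_mul]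
  by_cases hσ : X.IsCell σ
  · rw [upLap_apply_of_isCell X d f hσ, sum_localUpLap_apply_of_isCell X d f hσ]
    ring
  · have hfσ := hf.2 σ hσ
    have hsum : ∑ τ ∈ X.cellsCard d, X.localUpLap d τ f σ = 0 := sum_eq_zero fun τ hτ =>
      localUpLap_apply_of_not_isCell X (mem_filter.mp hτ).2 hσ hfσ
    rw [upLap_apply_of_not_isCell X _ f hσ, hfσ, hsum]
    simp
end

section
/- Let X be a finite abstract simplicial complex of dimension d, and let k be the maximal degree of a (d−1)-cell of X. Then the spectral gap satisfies λ(X) ≥ d·min_{τ∈X^{d-2}} λ(lk τ) − (d−1)·k, where λ(lk τ) is the graph spectral gap of the link graph lk τ (the minimal eigenvalue of its graph Laplacian on functions summing to zero). -/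
open Finset

/-- Variational lower bound for a linear map that preserves a subspace and is symmetric on it:
the Rayleigh quotient is at least any lower bound of the eigenvalues. -/
theorem mul_dotProduct_le_of_le_eigenvalue {ι : Type*} [Fintype ι] (S : Submodule ℝ (ι → ℝ))
    (T : (ι → ℝ) →ₗ[ℝ] (ι → ℝ)) (hT : ∀ x ∈ S, T x ∈ S)
    (hsymm : ∀ x ∈ S, ∀ y ∈ S, dotProduct (T x) y = dotProduct x (T y)) (c : ℝ)
    (hc : ∀ μ : ℝ, ∀ y ∈ S, y ≠ 0 → T y = μ • y → c ≤ μ) {x : ι → ℝ} (hx : x ∈ S) :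
    c * dotProduct x x ≤ dotProduct (T x) x := by
  classical
  let e : EuclideanSpace ℝ ι ≃ₗ[ℝ] (ι → ℝ) := WithLp.linearEquiv 2 ℝ _
  let S' : Submodule ℝ (EuclideanSpace ℝ ι) := S.comap e.toLinearMap
  let T₀ : EuclideanSpace ℝ ι →ₗ[ℝ] EuclideanSpace ℝ ι := e.symm.toLinearMap ∘ₗ T ∘ₗ e.toLinearMap
  have hT₀ : ∀ y ∈ S', T₀ y ∈ S' := fun y hy => hT _ hy
  let T' : S' →ₗ[ℝ] S' := T₀.restrict hT₀
  have inner_eq : ∀ y z : S', inner ℝ y z = dotProduct (e y) (e z) := fun y z => by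
    rw [Submodule.coe_inner, EuclideanSpace.inner_eq_star_dotProduct, dotProduct_comm]
    rfl
  have hsym : T'.IsSymmetric := fun y z => by
    rw [inner_eq, inner_eq]
    exact hsymm _ y.2 _ z.2
  let b := hsym.eigenvectorBasis rfl
  have hb : ∀ i, c ≤ hsym.eigenvalues rfl i := fun i => by
    refine hc _ (e (b i)) (b i).2 ?_ ?_
    · intro h
      have h0 : (b i : EuclideanSpace ℝ ι) = 0 := e.map_eq_zero_iff.mp h
      exact b.toBasis.ne_zero i (by simpa using h0)
    · exact congrArg (fun z : S' => e z) (hsym.apply_eigenvectorBasis rfl i)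
  let z : S' := ⟨e.symm x, by simpa [S'] using hx⟩
  have hz : e z = x := e.apply_symm_apply x
  have h1 : dotProduct x x = ∑ i, inner ℝ z (b i) * inner ℝ (b i) z := by
    rw [b.sum_inner_mul_inner, inner_eq, hz]
  have h2 : dotProduct (T x) x = ∑ i, inner ℝ (T' z) (b i) * inner ℝ (b i) z := by
    rw [b.sum_inner_mul_inner, inner_eq, hz]
    rfl
  rw [h1, h2, Finset.mul_sum]
  refine Finset.sum_le_sum fun i _ => ?_
  have h3 : inner ℝ (T' z) (b i) = hsym.eigenvalues rfl i * inner ℝ z (b i) := by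
    rw [hsym z (b i), hsym.apply_eigenvectorBasis, real_inner_smul_right]
    rfl
  rw [h3, real_inner_comm z (b i)]
  nlinarith [hb i, mul_self_nonneg (inner ℝ z (b i))]

/-- A linear map that preserves a nonzero subspace and is symmetric on it has an eigenvector
in that subspace. -/
theorem exists_eigenvector_mem {ι : Type*} [Fintype ι] (S : Submodule ℝ (ι → ℝ))
    (T : (ι → ℝ) →ₗ[ℝ] (ι → ℝ)) (hT : ∀ x ∈ S, T x ∈ S)
    (hsymm : ∀ x ∈ S, ∀ y ∈ S, dotProduct (T x) y = dotProduct x (T y))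
    {x : ι → ℝ} (hx : x ∈ S) (hx0 : x ≠ 0) : ∃ μ : ℝ, ∃ y ∈ S, y ≠ 0 ∧ T y = μ • y := by
  by_contra! h
  have hpos : 0 < dotProduct x x := by
    simpa using Matrix.dotProduct_star_self_pos_iff.mpr hx0
  have key := mul_dotProduct_le_of_le_eigenvalue S T hT hsymm
    ((dotProduct (T x) x + 1) / dotProduct x x)
    (fun μ y hy h0 hμ => absurd hμ (h μ y hy h0)) hx
  rw [div_mul_cancel₀ _ hpos.ne'] at key
  linarith

theorem sum_tuple_eq_sum_insertNth {α : Type*} [Fintype α] {m : ℕ} (i : Fin (m + 1))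
    (F : (Fin (m + 1) → α) → ℝ) : ∑ σ, F σ = ∑ v, ∑ τ : Fin m → α, F (i.insertNth v τ) := by
  classical
  rw [← Fintype.sum_prod_type']
  exact ((Fin.insertNthEquiv (fun _ => α) i).sum_comp F).symm

theorem sum_tuple_eq_sum_cons {α : Type*} [Fintype α] {m : ℕ} (F : (Fin (m + 1) → α) → ℝ) :
    ∑ σ, F σ = ∑ v, ∑ τ : Fin m → α, F (Fin.cons v τ) := by
  simpa using sum_tuple_eq_sum_insertNth 0 F

/-- Composing a face inclusion with a permutation gives a face inclusion, up to a
permutation of the face. -/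
theorem exists_perm_comp_succAbove {m : ℕ} (π : Equiv.Perm (Fin (m + 1))) (i : Fin (m + 1)) :
    ∃ ρ : Equiv.Perm (Fin m), π ∘ i.succAbove = (π i).succAbove ∘ ρ ∧
      ((Equiv.Perm.sign ρ : ℤ) : ℝ) =
        (-1) ^ ((π i : Fin (m + 1)) : ℕ) * ((Equiv.Perm.sign π : ℤ) : ℝ) * (-1) ^ (i : ℕ) := by
  let θ : Equiv.Perm (Fin (m + 1)) := (π i).cycleRange * π * i.cycleRange⁻¹
  obtain ⟨⟨p, ρ⟩, hρ⟩ := Equiv.Perm.decomposeFin.symm.surjective θ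
  have hp : p = 0 := by
    rw [← Equiv.Perm.decomposeFin_symm_apply_zero p ρ, hρ]
    simp [θ, Equiv.Perm.inv_def]
  subst hp
  refine ⟨ρ, ?_, ?_⟩
  · funext j
    have h : θ j.succ = (ρ j).succ := by
      rw [← hρ, Equiv.Perm.decomposeFin_symm_apply_succ]
      simp
    have h2 : (π i).cycleRange (π (i.succAbove j)) = (ρ j).succ := by
      simpa [θ, Equiv.Perm.inv_def] using h
    rw [Function.comp_apply, Function.comp_apply, ← Fin.cycleRange_symm_succ (π i), ← h2,
      Equiv.symm_apply_apply]
  · have h := congrArg Equiv.Perm.sign hρ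
    rw [Equiv.Perm.decomposeFin.symm_sign] at h
    simp only [if_true, one_mul] at h
    rw [h]
    simp [θ, Fin.sign_cycleRange]

theorem SComplex.tset_cons_s17 {V : Type} [DecidableEq V] {m : ℕ} (v : V) (σ : Fin m → V) :
    tset (Fin.cons v σ : Fin (m + 1) → V) = insert v (tset σ) := by
  ext w
  simp [tset, Fin.exists_fin_succ, eq_comm]

theorem SComplex.tset_comp_perm {V : Type} [DecidableEq V] {m : ℕ} (σ : Fin m → V)
    (π : Equiv.Perm (Fin m)) : tset (σ ∘ π) = tset σ := by
  ext w
  simp only [tset, mem_image, mem_univ, true_and, Function.comp_apply]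
  exact π.exists_congr_left.trans (by simp)

namespace SComplex

variable {V : Type} [Fintype V] [DecidableEq V]

theorem mem_linkNbrs_comm (X : SComplex V) (τ : Finset V) (v w : V) :
    w ∈ X.linkNbrs τ v ↔ v ∈ X.linkNbrs τ w := by
  simp only [linkNbrs, mem_filter, mem_univ, true_and]
  rw [Finset.insert_comm v w]
  tauto

theorem linkNbrs_eq_empty (X : SComplex V) {τ : Finset V} {v : V} (hv : v ∉ X.linkVerts τ) :
    X.linkNbrs τ v = ∅ := by
  refine Finset.eq_empty_of_forall_notMem fun w hw => hv ?_
  simp only [linkNbrs, linkVerts, mem_filter, mem_univ, true_and] at hw ⊢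
  exact ⟨hw.2.2.1, X.down_closed _ hw.2.2.2 _ (insert_subset_insert _ (subset_insert _ _))⟩

theorem linkLap_eq_zero (X : SComplex V) {τ : Finset V} (g : V → ℝ) {v : V}
    (hv : v ∉ X.linkVerts τ) : X.linkLap τ g v = 0 := by
  simp [linkLap, X.linkNbrs_eq_empty hv]

theorem linkLap_apply (X : SComplex V) (τ : Finset V) (g : V → ℝ) (v : V) :
    X.linkLap τ g v = ∑ w, if w ∈ X.linkNbrs τ v then g v - g w else 0 := by
  rw [← Finset.sum_filter, Finset.filter_mem_eq_inter, Finset.univ_inter]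
  simp [linkLap]

/-- The Dirichlet form of the link graph. -/
theorem two_mul_linkLap_dotProduct (X : SComplex V) (τ : Finset V) (g h : V → ℝ) :
    2 * dotProduct (X.linkLap τ g) h =
      ∑ v, ∑ w, if w ∈ X.linkNbrs τ v then (g v - g w) * (h v - h w) else 0 := by
  have h1 : dotProduct (X.linkLap τ g) h =
      ∑ v, ∑ w, if w ∈ X.linkNbrs τ v then (g v - g w) * h v else 0 := by
    simp only [dotProduct, linkLap_apply, Finset.sum_mul, ite_mul, zero_mul]
  have h2 : dotProduct (X.linkLap τ g) h =
      ∑ v, ∑ w, if w ∈ X.linkNbrs τ v then (g w - g v) * h w else 0 := by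
    rw [h1, Finset.sum_comm]
    exact Finset.sum_congr rfl fun v _ => Finset.sum_congr rfl fun w _ =>
      if_congr (X.mem_linkNbrs_comm τ w v) rfl rfl
  rw [two_mul]
  nth_rewrite 1 [h1]
  rw [h2, ← Finset.sum_add_distrib]
  refine Finset.sum_congr rfl fun v _ => ?_
  rw [← Finset.sum_add_distrib]
  refine Finset.sum_congr rfl fun w _ => ?_
  split_ifs <;> ring

theorem linkLap_dotProduct_comm (X : SComplex V) (τ : Finset V) (g h : V → ℝ) :
    dotProduct (X.linkLap τ g) h = dotProduct g (X.linkLap τ h) := by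
  have h1 := X.two_mul_linkLap_dotProduct τ g h
  have h2 := X.two_mul_linkLap_dotProduct τ h g
  simp only [mul_comm (h _ - h _)] at h2
  rw [dotProduct_comm g]
  linarith

theorem linkLap_dotProduct_self_nonneg (X : SComplex V) (τ : Finset V) (g : V → ℝ) :
    0 ≤ dotProduct (X.linkLap τ g) g := by
  have h := X.two_mul_linkLap_dotProduct τ g g
  have h2 : 0 ≤ ∑ v, ∑ w, if w ∈ X.linkNbrs τ v then (g v - g w) * (g v - g w) else 0 :=
    Finset.sum_nonneg fun v _ => Finset.sum_nonneg fun w _ => by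
      split_ifs
      exacts [mul_self_nonneg _, le_rfl]
  linarith

theorem sum_linkLap (X : SComplex V) (τ : Finset V) (g : V → ℝ) :
    ∑ v, X.linkLap τ g v = 0 := by
  simpa [dotProduct] using X.two_mul_linkLap_dotProduct τ g 1

/-- The graph Laplacian of the link of `τ` as a linear map. -/
def linkLapL (X : SComplex V) (τ : Finset V) : (V → ℝ) →ₗ[ℝ] (V → ℝ) where
  toFun := X.linkLap τ
  map_add' f g := by
    funext v
    simp only [linkLap, Pi.add_apply, Finset.sum_add_distrib]
    ring
  map_smul' c f := by
    funext v
    simp only [linkLap, Pi.smul_apply, smul_eq_mul, ← Finset.mul_sum, RingHom.id_apply]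
    ring

/-- Functions on the vertices of the link of `τ` which sum to zero. -/
def linkZeroSum (X : SComplex V) (τ : Finset V) : Submodule ℝ (V → ℝ) where
  carrier := {g | (∀ v, v ∉ X.linkVerts τ → g v = 0) ∧ ∑ v, g v = 0}
  add_mem' := fun {f g} hf hg => ⟨fun v hv => by simp [hf.1 v hv, hg.1 v hv], by
    simp [Finset.sum_add_distrib, hf.2, hg.2]⟩
  zero_mem' := by simp
  smul_mem' := fun c f hf => ⟨fun v hv => by simp [hf.1 v hv], by
    simp [← Finset.mul_sum, hf.2]⟩

theorem mem_linkZeroSum {X : SComplex V} {τ : Finset V} {g : V → ℝ} :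
    g ∈ X.linkZeroSum τ ↔ (∀ v, v ∉ X.linkVerts τ → g v = 0) ∧ ∑ v, g v = 0 :=
  Iff.rfl

/-- Variational characterization (lower bound) of the spectral gap of the link graph. -/
theorem linkGap_mul_le (X : SComplex V) (τ : Finset V) {g : V → ℝ} (hg : g ∈ X.linkZeroSum τ) :
    X.linkGap τ * dotProduct g g ≤ dotProduct (X.linkLap τ g) g := by
  have sum_verts : ∀ {f : V → ℝ}, (∀ v, v ∉ X.linkVerts τ → f v = 0) →
      ∑ v ∈ X.linkVerts τ, f v = ∑ v, f v := fun hf =>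
    Finset.sum_subset (Finset.subset_univ _) fun v _ hv => hf v hv
  have eigen : ∀ {f : V → ℝ} {μ : ℝ}, (∀ v, v ∉ X.linkVerts τ → f v = 0) →
      (∀ v ∈ X.linkVerts τ, X.linkLap τ f v = μ * f v) → X.linkLap τ f = μ • f := by
    intro f μ hf h
    funext v
    by_cases hv : v ∈ X.linkVerts τ
    · exact h v hv
    · simp [X.linkLap_eq_zero f hv, hf v hv]
  refine mul_dotProduct_le_of_le_eigenvalue (X.linkZeroSum τ) (X.linkLapL τ)
    (fun f _ => ⟨fun v hv => X.linkLap_eq_zero f hv, X.sum_linkLap τ f⟩)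
    (fun f _ h _ => X.linkLap_dotProduct_comm τ f h) _ (fun μ f hf hf0 hμ => ?_) hg
  refine csInf_le ⟨0, ?_⟩ ⟨f, hf.1, (sum_verts hf.1).trans hf.2, hf0, fun v _ => congrFun hμ v⟩
  rintro ν ⟨h, hh, -, hh0, hν⟩
  have h1 := X.linkLap_dotProduct_self_nonneg τ h
  rw [eigen hh hν, smul_dotProduct, smul_eq_mul] at h1
  have h2 : 0 < dotProduct h h := by simpa using Matrix.dotProduct_star_self_pos_iff.mpr hh0
  exact nonneg_of_mul_nonneg_left h1 h2

theorem isCell_cons_iff (X : SComplex V) {m : ℕ} (v : V) (σ : Fin m → V) :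
    X.IsCell (Fin.cons v σ : Fin (m + 1) → V) ↔ Function.Injective σ ∧ X.nbr v σ := by
  rw [IsCell, tset_cons_s17, Fin.cons_injective_iff, nbr]
  simp only [tset, mem_image, mem_univ, true_and, Set.mem_range]
  tauto

theorem isCell_of_isCell_cons (X : SComplex V) {m : ℕ} {v : V} {σ : Fin m → V}
    (h : X.IsCell (Fin.cons v σ : Fin (m + 1) → V)) : X.IsCell σ := by
  rw [isCell_cons_iff] at h
  exact ⟨h.1, X.down_closed _ h.2.2 _ (subset_insert _ _)⟩

theorem isCell_comp_perm (X : SComplex V) {m : ℕ} (σ : Fin m → V) (π : Equiv.Perm (Fin m)) :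
    X.IsCell (σ ∘ π) ↔ X.IsCell σ := by
  rw [IsCell, IsCell, tset_comp_perm, Equiv.injective_comp]

namespace IsForm

variable {X : SComplex V} {m : ℕ}

theorem isCell_of_ne_zero {f : (Fin m → V) → ℝ} (hf : X.IsForm m f) {σ : Fin m → V}
    (h : f σ ≠ 0) : X.IsCell σ :=
  by_contra fun hσ => h (hf.2 σ hσ)

theorem apply_insertNth {f : (Fin (m + 1) → V) → ℝ} (hf : X.IsForm (m + 1) f) (i : Fin (m + 1))
    (v : V) (τ : Fin m → V) :
    f (i.insertNth v τ) = (-1) ^ (i : ℕ) * f (Fin.cons v τ) := by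
  rw [← Fin.cons_comp_cycleRange, hf.1, Fin.sign_cycleRange]
  simp

theorem bdry_apply {f : (Fin (m + 1) → V) → ℝ} (hf : X.IsForm (m + 1) f) (σ : Fin m → V) :
    X.bdry m f σ = ∑ v, f (Fin.cons v σ) := by
  refine Finset.sum_congr rfl fun v _ => ?_
  split_ifs with h
  · rfl
  · exact (hf.2 _ fun hc => h ((X.isCell_cons_iff v σ).mp hc).2).symm

theorem bdry {f : (Fin (m + 1) → V) → ℝ} (hf : X.IsForm (m + 1) f) :
    X.IsForm m (X.bdry m f) := by
  refine ⟨fun σ π => ?_, fun σ hσ => ?_⟩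
  · rw [hf.bdry_apply, hf.bdry_apply, Finset.mul_sum]
    refine Finset.sum_congr rfl fun v _ => ?_
    have h : (Fin.cons v (σ ∘ π) : Fin (m + 1) → V) =
        (Fin.cons v σ : Fin (m + 1) → V) ∘ Equiv.Perm.decomposeFin.symm (0, π) := by
      funext j
      cases j using Fin.cases <;> simp
    rw [h, hf.1]
    simp
  · rw [hf.bdry_apply]
    exact Finset.sum_eq_zero fun v _ => hf.2 _ fun h => hσ (X.isCell_of_isCell_cons h)

theorem cobdry {f : (Fin m → V) → ℝ} (hf : X.IsForm m f) :
    X.IsForm (m + 1) (X.cobdry m f) := by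
  refine ⟨fun σ π => ?_, fun σ hσ => if_neg hσ⟩
  unfold SComplex.cobdry
  simp only [X.isCell_comp_perm σ π, mul_ite, mul_zero]
  refine if_congr Iff.rfl ?_ rfl
  rw [Finset.mul_sum, ← Equiv.sum_comp π (fun j => _ * ((-1 : ℝ) ^ (j : ℕ) * f (σ ∘ j.succAbove)))]
  refine Finset.sum_congr rfl fun i _ => ?_
  obtain ⟨ρ, hρ, hsign⟩ := exists_perm_comp_succAbove π i
  rw [Function.comp_assoc, hρ, ← Function.comp_assoc, hf.1, hsign]
  have h : ((-1 : ℝ) ^ (i : ℕ)) * (-1) ^ (i : ℕ) = 1 := by rw [← mul_pow]; simp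
  linear_combination ((-1) ^ ((π i : Fin (m + 1)) : ℕ) * ((Equiv.Perm.sign π : ℤ) : ℝ) *
    f (σ ∘ (π i).succAbove)) * h

theorem bdry_bdry {f : (Fin (m + 2) → V) → ℝ} (hf : X.IsForm (m + 2) f) :
    X.bdry m (X.bdry (m + 1) f) = 0 := by
  funext σ
  rw [hf.bdry.bdry_apply]
  simp only [hf.bdry_apply]
  have swap : ∀ v w : V, f (Fin.cons w (Fin.cons v σ)) = -f (Fin.cons v (Fin.cons w σ)) := by
    intro v w
    have h : (Fin.cons w (Fin.cons v σ : Fin (m + 1) → V) : Fin (m + 2) → V) =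
        Fin.cons v (Fin.cons w σ : Fin (m + 1) → V) ∘ Equiv.swap 0 1 := by
      funext j
      refine Fin.cases ?_ (fun j => Fin.cases ?_ (fun j => ?_) j) j
      · rw [Function.comp_apply, Equiv.swap_apply_left]
        rfl
      · rw [Function.comp_apply, Fin.succ_zero_eq_one, Equiv.swap_apply_right]
        rfl
      · rw [Function.comp_apply, ← Fin.succ_zero_eq_one,
          Equiv.swap_apply_of_ne_of_ne (Fin.succ_ne_zero _)
          fun h => Fin.succ_ne_zero j (Fin.succ_injective (m + 1) h)]
        rfl
    rw [h, hf.1]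
    simp
  have h : ∑ v, ∑ w, f (Fin.cons w (Fin.cons v σ)) =
      -∑ v, ∑ w, f (Fin.cons w (Fin.cons v σ)) := by
    conv_lhs => rw [Finset.sum_comm]
    rw [← Finset.sum_neg_distrib]
    refine Finset.sum_congr rfl fun v _ => ?_
    rw [← Finset.sum_neg_distrib]
    exact Finset.sum_congr rfl fun w _ => swap w v
  simpa using self_eq_neg.mp h

/-- The coboundary is adjoint to the boundary. -/
theorem dotProduct_cobdry {f : (Fin (m + 1) → V) → ℝ} (hf : X.IsForm (m + 1) f)
    (g : (Fin m → V) → ℝ) :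
    dotProduct f (X.cobdry m g) = (m + 1) * dotProduct (X.bdry m f) g := by
  have h1 : dotProduct f (X.cobdry m g) =
      ∑ i : Fin (m + 1), ∑ σ, f σ * ((-1) ^ (i : ℕ) * g (σ ∘ i.succAbove)) := by
    rw [Finset.sum_comm]
    refine Finset.sum_congr rfl fun σ _ => ?_
    rw [← Finset.mul_sum]
    by_cases hσ : X.IsCell σ
    · simp [SComplex.cobdry, hσ]
    · simp [hf.2 σ hσ]
  have h2 : ∀ i : Fin (m + 1), ∑ σ, f σ * ((-1) ^ (i : ℕ) * g (σ ∘ i.succAbove)) =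
      dotProduct (X.bdry m f) g := by
    intro i
    rw [sum_tuple_eq_sum_insertNth i, Finset.sum_comm]
    refine Finset.sum_congr rfl fun τ _ => ?_
    rw [hf.bdry_apply, Finset.sum_mul]
    refine Finset.sum_congr rfl fun v _ => ?_
    have hτ : (i.insertNth v τ : Fin (m + 1) → V) ∘ i.succAbove = τ := by
      funext j
      simp
    have h : ((-1 : ℝ) ^ (i : ℕ)) * (-1) ^ (i : ℕ) = 1 := by rw [← mul_pow]; simp
    rw [hτ, hf.apply_insertNth]
    linear_combination (f (Fin.cons v τ) * g τ) * h
  simp [h1, h2]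

theorem upLap {f : (Fin m → V) → ℝ} (hf : X.IsForm m f) : X.IsForm m (X.upLap m f) :=
  hf.cobdry.bdry

theorem upLap_dotProduct_comm {f g : (Fin m → V) → ℝ} (hf : X.IsForm m f) (hg : X.IsForm m g) :
    dotProduct (X.upLap m f) g = dotProduct f (X.upLap m g) := by
  have h1 := hf.cobdry.dotProduct_cobdry g
  have h2 := hg.cobdry.dotProduct_cobdry f
  rw [dotProduct_comm, h1, dotProduct_comm _ f] at h2
  exact mul_left_cancel₀ (by positivity) h2

end IsForm

/-- The quadratic form `∑ σ, deg σ * f σ ^ 2`. -/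
def degForm (X : SComplex V) (m : ℕ) (f : (Fin m → V) → ℝ) : ℝ :=
  ∑ σ, ∑ w, if X.nbr w σ then f σ * f σ else 0

/-- The sum of `f (vτ) * f (wτ)` over all ordered tuples `τ` and adjacent vertices `v`, `w` of
the link of `τ`. -/
def crossForm (X : SComplex V) (m : ℕ) (f : (Fin (m + 1) → V) → ℝ) : ℝ :=
  ∑ τ : Fin m → V, ∑ v, ∑ w,
    if X.nbr w (Fin.cons v τ : Fin (m + 1) → V) then f (Fin.cons v τ) * f (Fin.cons w τ) else 0

theorem card_nbr_le_maxDeg (X : SComplex V) {m : ℕ} {σ : Fin m → V} (hσ : X.IsCell σ) :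
    #{w | X.nbr w σ} ≤ X.maxDeg m := by
  have hcard : (tset σ).card = m := by
    rw [tset, Finset.card_image_of_injective _ hσ.1, Finset.card_univ, Fintype.card_fin]
  have h1 : #{w | X.nbr w σ} ≤ X.degCell (tset σ) := by
    refine Finset.card_le_card_of_injOn (fun w => insert w (tset σ)) ?_ ?_
    · intro w hw
      have hw : X.nbr w σ := by simpa using hw
      exact mem_coe.mpr <| mem_filter.mpr ⟨hw.2, subset_insert _ _, card_insert_of_notMem hw.1⟩
    · intro v hv w hw hvw
      have hv : X.nbr v σ := by simpa using hv
      have hvw : insert v (tset σ) = insert w (tset σ) := hvw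
      exact (mem_insert.mp (hvw ▸ mem_insert_self v (tset σ))).resolve_right hv.1
  exact h1.trans (Finset.le_sup (f := fun s => X.degCell s)
    (mem_filter.mpr ⟨hσ.2, hcard⟩ : tset σ ∈ X.cellsCard m))

namespace IsForm

variable {X : SComplex V} {m : ℕ}

theorem degForm_le {f : (Fin m → V) → ℝ} (hf : X.IsForm m f) :
    X.degForm m f ≤ X.maxDeg m * dotProduct f f := by
  rw [degForm, dotProduct, Finset.mul_sum]
  refine Finset.sum_le_sum fun σ _ => ?_
  by_cases hσ : X.IsCell σ
  · rw [← Finset.sum_filter, Finset.sum_const, nsmul_eq_mul]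
    exact mul_le_mul_of_nonneg_right (by exact_mod_cast X.card_nbr_le_maxDeg hσ)
      (mul_self_nonneg _)
  · simp [hf.2 σ hσ]

theorem upLap_apply {f : (Fin (m + 1) → V) → ℝ} {σ : Fin (m + 1) → V} (hσ : X.IsCell σ) :
    X.upLap (m + 1) f σ = ∑ w, if X.nbr w σ then
      f σ - ∑ i : Fin (m + 1), (-1) ^ (i : ℕ) * f (Fin.cons w (σ ∘ i.succAbove)) else 0 := by
  refine Finset.sum_congr rfl fun w _ => if_ctx_congr Iff.rfl (fun hw => ?_) fun _ => rfl
  rw [SComplex.cobdry, if_pos ((X.isCell_cons_iff w σ).mpr ⟨hσ.1, hw⟩), Fin.sum_univ_succ,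
    sub_eq_add_neg, ← Finset.sum_neg_distrib]
  congr 1
  · simp only [Fin.val_zero, pow_zero, one_mul]
    congr 1
  · refine Finset.sum_congr rfl fun i _ => ?_
    have h : (Fin.cons w σ : Fin (m + 2) → V) ∘ i.succ.succAbove =
        Fin.cons w (σ ∘ i.succAbove) := by
      funext j
      cases j using Fin.cases <;> simp
    rw [h, Fin.val_succ, pow_succ]
    ring

theorem upLap_dotProduct_self {f : (Fin (m + 1) → V) → ℝ} (hf : X.IsForm (m + 1) f) :
    dotProduct (X.upLap (m + 1) f) f = X.degForm (m + 1) f - (m + 1) * X.crossForm m f := by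
  have h1 : dotProduct (X.upLap (m + 1) f) f = X.degForm (m + 1) f -
      ∑ i : Fin (m + 1), ∑ σ, ∑ w, if X.nbr w σ then
        f σ * ((-1) ^ (i : ℕ) * f (Fin.cons w (σ ∘ i.succAbove))) else 0 := by
    rw [degForm, Finset.sum_comm (s := (univ : Finset (Fin (m + 1)))), ← Finset.sum_sub_distrib]
    refine Finset.sum_congr rfl fun σ _ => ?_
    by_cases hσ : X.IsCell σ
    · rw [upLap_apply hσ, Finset.sum_comm, ← Finset.sum_sub_distrib, Finset.sum_mul]
      refine Finset.sum_congr rfl fun w _ => ?_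
      split_ifs
      · rw [← Finset.mul_sum]
        ring
      · simp
    · simp [hf.2 σ hσ]
  have h2 : ∀ i : Fin (m + 1), (∑ σ, ∑ w, if X.nbr w σ then
      f σ * ((-1) ^ (i : ℕ) * f (Fin.cons w (σ ∘ i.succAbove))) else 0) = X.crossForm m f := by
    intro i
    rw [sum_tuple_eq_sum_insertNth i, Finset.sum_comm]
    refine Finset.sum_congr rfl fun τ _ => Finset.sum_congr rfl fun v _ =>
      Finset.sum_congr rfl fun w _ => ?_
    have hτ : (i.insertNth v τ : Fin (m + 1) → V) ∘ i.succAbove = τ := by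
      funext j
      simp
    have hn : X.nbr w (i.insertNth v τ : Fin (m + 1) → V) ↔
        X.nbr w (Fin.cons v τ : Fin (m + 1) → V) := by
      rw [nbr, nbr, ← Fin.cons_comp_cycleRange, tset_comp_perm]
    refine if_congr hn ?_ rfl
    have h : ((-1 : ℝ) ^ (i : ℕ)) * (-1) ^ (i : ℕ) = 1 := by rw [← mul_pow]; simp
    rw [hτ, hf.apply_insertNth]
    linear_combination (f (Fin.cons v τ) * f (Fin.cons w τ)) * h
  simp [h1, h2]

/-- The restriction of a cycle to the link of a cell sums to zero. -/
theorem cons_mem_linkZeroSum {f : (Fin (m + 1) → V) → ℝ} (hf : X.IsForm (m + 1) f)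
    (hf0 : X.bdry m f = 0) (τ : Fin m → V) :
    (fun v => f (Fin.cons v τ)) ∈ X.linkZeroSum (tset τ) := by
  refine mem_linkZeroSum.mpr ⟨fun v hv => hf.2 _ fun h => hv ?_, ?_⟩
  · simpa [linkVerts, nbr] using ((X.isCell_cons_iff v τ).mp h).2
  · rw [← hf.bdry_apply, hf0]
    rfl

/-- Garland's local-to-global estimate. -/
theorem mul_dotProduct_le_degForm_sub_crossForm {f : (Fin (m + 1) → V) → ℝ}
    (hf : X.IsForm (m + 1) f) (hf0 : X.bdry m f = 0) {c : ℝ}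
    (hc : ∀ s ∈ X.cellsCard m, c ≤ X.linkGap s) :
    c * dotProduct f f ≤ X.degForm (m + 1) f - X.crossForm m f := by
  rw [degForm, crossForm, dotProduct, sum_tuple_eq_sum_cons, sum_tuple_eq_sum_cons,
    Finset.sum_comm, Finset.sum_comm (s := (univ : Finset V)), ← Finset.sum_sub_distrib,
    Finset.mul_sum]
  refine Finset.sum_le_sum fun τ _ => ?_
  by_cases hτ : X.IsCell τ
  · have hcard : (tset τ).card = m := by
      rw [tset, Finset.card_image_of_injective _ hτ.1, Finset.card_univ, Fintype.card_fin]
    refine (mul_le_mul_of_nonneg_right (hc (tset τ) (mem_filter.mpr ⟨hτ.2, hcard⟩))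
      (Finset.sum_nonneg fun v _ => mul_self_nonneg _)).trans
      ((X.linkGap_mul_le (tset τ) (hf.cons_mem_linkZeroSum hf0 τ)).trans_eq ?_)
    rw [dotProduct, ← Finset.sum_sub_distrib]
    refine Finset.sum_congr rfl fun v _ => ?_
    rw [linkLap_apply, Finset.sum_mul, ← Finset.sum_sub_distrib]
    refine Finset.sum_congr rfl fun w _ => ?_
    by_cases hv : f (Fin.cons v τ) = 0
    · simp [hv]
    have hvτ := ((X.isCell_cons_iff v τ).mp (hf.isCell_of_ne_zero hv)).2.1
    have hn : w ∈ X.linkNbrs (tset τ) v ↔ X.nbr w (Fin.cons v τ : Fin (m + 1) → V) := by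
      simp only [linkNbrs, mem_filter, mem_univ, true_and, nbr, tset_cons_s17, mem_insert]
      rw [Finset.insert_comm]
      tauto
    simp only [hn]
    split_ifs <;> ring
  · have h : ∀ v, f (Fin.cons v τ) = 0 := fun v =>
      hf.2 _ fun h => hτ (X.isCell_of_isCell_cons h)
    simp [h]

end IsForm

/-- Some form supported on the orderings of a given cell has nonzero boundary. -/
theorem exists_isForm_bdry_ne_zero (X : SComplex V) {m : ℕ} {s : Finset V} (hs : s ∈ X.cells)
    (hcard : s.card = m + 1) : ∃ f, X.IsForm (m + 1) f ∧ X.bdry m f ≠ 0 := by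
  let e : Fin (m + 1) ≃ s := (s.equivFinOfCardEq hcard).symm
  let ρ : Fin (m + 1) → V := fun i => e i
  have hρ : Function.Injective ρ := Subtype.val_injective.comp e.injective
  let M : (Fin (m + 1) → V) → Matrix (Fin (m + 1)) (Fin (m + 1)) ℝ :=
    fun σ => Matrix.of fun i j => if σ i = ρ j then 1 else 0
  have not_inj : ∀ σ, ¬ Function.Injective σ → (M σ).det = 0 := fun σ hσ => by
    simp only [Function.Injective, not_forall] at hσ
    obtain ⟨i, j, hij, hne⟩ := hσ
    exact Matrix.det_zero_of_row_eq hne (by funext k; simp [M, hij])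
  have not_range : ∀ σ i, σ i ∉ s → (M σ).det = 0 := fun σ i hi =>
    Matrix.det_eq_zero_of_row_eq_zero i fun j =>
      if_neg fun h : σ i = ρ j => hi (h ▸ (e j).2)
  have hform : X.IsForm (m + 1) fun σ => (M σ).det := by
    refine ⟨fun σ π => Matrix.det_permute π (M σ), fun σ hσ => ?_⟩
    by_cases hinj : Function.Injective σ
    · have : ∃ i, σ i ∉ s := by
        by_contra! h
        exact hσ ⟨hinj, X.down_closed s hs _ (by simpa [tset, Finset.image_subset_iff] using h)⟩
      exact not_range σ this.choose this.choose_spec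
    · exact not_inj σ hinj
  refine ⟨_, hform, fun h => ?_⟩
  have h1 := congrFun h (Fin.tail ρ)
  rw [hform.bdry_apply, Finset.sum_eq_single (ρ 0)] at h1
  · have hM : M ρ = 1 := by
      ext i j
      simp [M, Matrix.one_apply, hρ.eq_iff]
    simp [hM] at h1
  · intro v _ hv
    by_cases hvs : v ∈ s
    · refine not_inj _ fun hinj => ?_
      have hv' : ρ (e.symm ⟨v, hvs⟩) = v := by simp [ρ]
      obtain hj | ⟨j, hj⟩ := Fin.eq_zero_or_eq_succ (e.symm ⟨v, hvs⟩)
      · exact hv (by rw [← hv', hj])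
      · refine (Fin.succ_ne_zero j) (hinj ?_)
        rw [Fin.cons_succ, Fin.cons_zero, Fin.tail, ← hj, hv']
    · exact not_range _ 0 (by simpa using hvs)
  · simp

theorem specUpLapZ_nonempty (X : SComplex V) {d : ℕ} (hdim : X.Dim (d + 1)) :
    (X.specUpLapZ d).Nonempty := by
  obtain ⟨s, hs, hcard⟩ := hdim.2
  obtain ⟨f, hf, hf0⟩ := X.exists_isForm_bdry_ne_zero hs hcard
  obtain ⟨μ, g, hg, hg0, hμ⟩ := exists_eigenvector_mem
    (X.formSub (d + 1) ⊓ LinearMap.ker (X.bdryL d)) (X.bdryL (d + 1) ∘ₗ X.cobdryL (d + 1))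
    (fun g hg => ⟨IsForm.upLap hg.1, (IsForm.cobdry hg.1).bdry_bdry⟩)
    (fun g hg h hh => IsForm.upLap_dotProduct_comm hg.1 hh.1)
    (x := X.bdry (d + 1) f) ⟨hf.bdry, hf.bdry_bdry⟩ hf0
  exact ⟨μ, g, hg.1, hg.2, hg0, hμ⟩

end SComplex

open SComplex in
/-- The spectral bound of Section 4.2 (following Garland): for a `(d+1)`-dimensional
complex with `k` the maximal degree of a cell with `d+1` vertices,
`λ(X) ≥ (d+1)·min_{τ ∈ X^{d-1}} λ(lk τ) − d·k`, where the minimum of the graph spectral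
gaps of the links runs over all cells `τ` with `d` vertices. -/
theorem spectralGap_ge_link_gaps (V : Type) [Fintype V] [DecidableEq V] (d : ℕ)
    (X : SComplex V) (hdim : X.Dim (d + 1))
    (lmin : ℝ) (hlmin : IsLeast {r : ℝ | ∃ τ ∈ X.cellsCard d, r = X.linkGap τ} lmin) :
    ((d : ℝ) + 1) * lmin - (d : ℝ) * (X.maxDeg (d + 1) : ℝ) ≤ X.spectralGap d := by
  refine le_csInf (X.specUpLapZ_nonempty hdim) ?_
  rintro μ ⟨f, hf, hcycle, hf0, hμ⟩
  have hpos : 0 < dotProduct f f := by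
    simpa using Matrix.dotProduct_star_self_pos_iff.mpr hf0
  have hlocal := hf.mul_dotProduct_le_degForm_sub_crossForm hcycle
    fun s hs => hlmin.2 ⟨s, hs, rfl⟩
  have hdeg := mul_le_mul_of_nonneg_left hf.degForm_le (Nat.cast_nonneg (α := ℝ) d)
  have hglobal := hf.upLap_dotProduct_self
  rw [hμ, smul_dotProduct, smul_eq_mul] at hglobal
  refine le_of_mul_le_mul_right ?_ hpos
  have hlocal' := mul_le_mul_of_nonneg_left hlocal (by positivity : (0 : ℝ) ≤ d + 1)
  linarith
end
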